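/- arXiv:math/9409222 — 2 statements merged into one kernel-verified Lean document; each statement's English description precedes it below -/
import Mathlib

section
/- Let P be a finite set of points in the Euclidean plane in convex position, meaning that no point p of P lies in the convex hull of P \ {p}. Let k ≤ |P|, let S be a k-element subset of P, and let T be a tree on S whose length is at most the length of every tree on every k-element subset of P (i.e., T is an optimal k-point spanning tree of P). Then every vertex of T has degree at most 4 in T. -/
open scoped Classical

/-- The total Euclidean length of a graph on a finite set of points in the plane. -/
noncomputable def treeLength {S : Finset (EuclideanSpace ℝ (Fin 2))} (T : SimpleGraph S) : ℝ :=
  ∑ e ∈ T.edgeFinset,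
    Sym2.lift ⟨fun (a b : S) => dist (a : EuclideanSpace ℝ (Fin 2)) (b : EuclideanSpace ℝ (Fin 2)),
      fun _ _ => dist_comm _ _⟩ e

/-- Two nonzero vectors in the closed octant `0 ≤ b ≤ a` are closer to each other than the longer
one is to the origin. -/
lemma false_of_octant {a b c d : ℝ} (ha : 0 < a) (hb : 0 ≤ b) (hab : b ≤ a)
    (hc : 0 < c) (hd : 0 ≤ d) (hcd : d ≤ c)
    (h₁ : 2 * (a * c + b * d) ≤ a ^ 2 + b ^ 2) (h₂ : 2 * (a * c + b * d) ≤ c ^ 2 + d ^ 2) :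
    False := by
  have hbd := mul_nonneg hb hd
  rcases lt_trichotomy a c with h | h | h
  · nlinarith [mul_lt_mul_of_pos_left h ha]
  · subst h
    have hb' : b = a := by nlinarith
    have hd' : d = a := by nlinarith
    subst hb' hd'
    nlinarith
  · nlinarith [mul_lt_mul_of_pos_left h hc]

/-- Two vectors in the same one of the four octants of an open half-plane subtend an angle
smaller than `π / 3`. -/
lemma false_of_same_octant {a b c d : ℝ} (ha : 0 < a) (hc : 0 < c)
    (hs : 0 ≤ b ↔ 0 ≤ d) (ho : |b| ≤ a ↔ |d| ≤ c)
    (h₁ : 2 * (a * c + b * d) ≤ a ^ 2 + b ^ 2) (h₂ : 2 * (a * c + b * d) ≤ c ^ 2 + d ^ 2) :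
    False := by
  have hbd : |b| * |d| = b * d := by
    by_cases hb : 0 ≤ b
    · rw [abs_of_nonneg hb, abs_of_nonneg (hs.1 hb)]
    · have hd : ¬ 0 ≤ d := fun h => hb (hs.2 h)
      rw [abs_of_neg (not_le.1 hb), abs_of_neg (not_le.1 hd)]
      ring
  rw [← hbd, ← sq_abs b] at h₁
  rw [← hbd, ← sq_abs d] at h₂
  by_cases h : |b| ≤ a
  · exact false_of_octant ha (abs_nonneg b) h hc (abs_nonneg d) (ho.1 h) h₁ h₂
  · have h' : ¬ |d| ≤ c := fun h' => h (ho.2 h')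
    push Not at h h'
    exact false_of_octant (ha.trans h) ha.le h.le (hc.trans h') hc.le h'.le
      (by linarith) (by linarith)

lemma treeLength_mono {S : Finset (EuclideanSpace ℝ (Fin 2))} {G H : SimpleGraph S} (h : G ≤ H) :
    treeLength G ≤ treeLength H := by
  refine Finset.sum_le_sum_of_subset_of_nonneg (SimpleGraph.edgeFinset_mono h) ?_
  rintro ⟨a, b⟩ - -
  exact dist_nonneg (x := (a : EuclideanSpace ℝ (Fin 2))) (y := b)

/-- Replacing the edge `vu` of a connected graph by the edge `wu`, where `w` is another neighbor
of `v`, keeps it connected. -/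
lemma SimpleGraph.Connected.deleteEdges_sup_edge {V : Type*} {G : SimpleGraph V}
    (hG : G.Connected) {v u w : V} (hvw : G.Adj v w) (huw : u ≠ w) :
    (G.deleteEdges {s(v, u)} ⊔ SimpleGraph.edge w u).Connected := by
  set H := G.deleteEdges {s(v, u)} ⊔ SimpleGraph.edge w u with hH
  have hadj : ∀ x y, G.Adj x y → s(x, y) ≠ s(v, u) → H.Adj x y := by
    intro x y hxy hne
    exact Or.inl (SimpleGraph.deleteEdges_adj.2 ⟨hxy, hne⟩)
  have hwu : H.Adj w u := Or.inr ((SimpleGraph.edge_adj ..).2 ⟨Or.inl ⟨rfl, rfl⟩, huw.symm⟩)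
  have hvw' : H.Adj v w := hadj v w hvw (by
    intro h
    rcases Sym2.eq_iff.1 h with ⟨-, h⟩ | ⟨-, h⟩
    · exact huw h.symm
    · exact hvw.ne h.symm)
  have hvu : H.Reachable v u := hvw'.reachable.trans hwu.reachable
  have hstep : ∀ x y, G.Adj x y → H.Reachable x y := by
    intro x y hxy
    by_cases h : s(x, y) = s(v, u)
    · rcases Sym2.eq_iff.1 h with ⟨rfl, rfl⟩ | ⟨rfl, rfl⟩
      · exact hvu
      · exact hvu.symm
    · exact (hadj x y hxy h).reachable
  have := hG.nonempty
  refine ⟨fun x y => ?_⟩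
  obtain ⟨p⟩ := hG.preconnected x y
  induction p with
  | nil => exact SimpleGraph.Reachable.refl _
  | cons h _ ih => exact (hstep _ _ h).trans ih

lemma treeLength_deleteEdges_sup_edge_le {S : Finset (EuclideanSpace ℝ (Fin 2))}
    {G : SimpleGraph S} {v u w : S} (hvu : G.Adj v u) :
    treeLength (G.deleteEdges {s(v, u)} ⊔ SimpleGraph.edge w u) +
        dist (v : EuclideanSpace ℝ (Fin 2)) u ≤
      treeLength G + dist (w : EuclideanSpace ℝ (Fin 2)) u := by
  obtain ⟨H, hH⟩ : ∃ H, H = G.deleteEdges {s(v, u)} ⊔ SimpleGraph.edge w u := ⟨_, rfl⟩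
  rw [← hH]
  unfold treeLength
  set f : Sym2 S → ℝ := Sym2.lift ⟨fun (a b : S) =>
    dist (a : EuclideanSpace ℝ (Fin 2)) (b : EuclideanSpace ℝ (Fin 2)),
      fun _ _ => dist_comm _ _⟩
  have hf0 : ∀ e, 0 ≤ f e := by
    rintro ⟨a, b⟩
    exact dist_nonneg (x := (a : EuclideanSpace ℝ (Fin 2))) (y := b)
  have hsub : H.edgeFinset ⊆ G.edgeFinset.erase s(v, u) ∪ {s(w, u)} := by
    intro e
    induction e with | _ x y
    simp only [hH, SimpleGraph.mem_edgeFinset, SimpleGraph.mem_edgeSet, ne_eq, SimpleGraph.sup_adj,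
      SimpleGraph.deleteEdges_adj, SimpleGraph.edge_adj, Finset.mem_union, Finset.mem_erase,
      Finset.mem_singleton, Set.mem_singleton_iff, Sym2.eq_iff]
    tauto
  have h₁ := Finset.sum_le_sum_of_subset_of_nonneg hsub (fun e _ _ => hf0 e)
  have h₂ : ∑ e ∈ G.edgeFinset.erase s(v, u) ∪ {s(w, u)}, f e ≤
      ∑ e ∈ G.edgeFinset.erase s(v, u), f e + ∑ e ∈ {s(w, u)}, f e := by
    rw [← Finset.sum_union_inter]
    exact le_add_of_nonneg_right (Finset.sum_nonneg fun e _ => hf0 e)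
  have h₃ := Finset.sum_erase_add G.edgeFinset f (a := s(v, u))
    (SimpleGraph.mem_edgeFinset.2 hvu)
  rw [Finset.sum_singleton] at h₂
  have h₄ : f s(v, u) = dist (v : EuclideanSpace ℝ (Fin 2)) u := rfl
  have h₅ : f s(w, u) = dist (w : EuclideanSpace ℝ (Fin 2)) u := rfl
  linarith

/-- In a minimum spanning tree, two neighbors of a vertex are at least as far from each other
as from that vertex. -/
lemma dist_le_dist_of_minimal_tree {S : Finset (EuclideanSpace ℝ (Fin 2))} {T : SimpleGraph S}
    (hT : T.IsTree) (hmin : ∀ T' : SimpleGraph S, T'.IsTree → treeLength T ≤ treeLength T')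
    {v u w : S} (hvu : T.Adj v u) (hvw : T.Adj v w) (huw : u ≠ w) :
    dist (v : EuclideanSpace ℝ (Fin 2)) u ≤ dist (w : EuclideanSpace ℝ (Fin 2)) u := by
  obtain ⟨T', hle, hT'⟩ := (hT.connected.deleteEdges_sup_edge hvw huw).exists_isTree_le
  have := treeLength_deleteEdges_sup_edge_le (w := w) hvu
  linarith [hmin T' hT', treeLength_mono hle]

/-- A point outside the convex hull of a finite planar set is strictly separated from it
by a linear functional, given in coordinates. -/
lemma exists_separating_coordinates {A : Set (EuclideanSpace ℝ (Fin 2))} (hA : A.Finite)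
    {p : EuclideanSpace ℝ (Fin 2)} (hp : p ∉ convexHull ℝ A) :
    ∃ s t : ℝ, ∀ x ∈ A, 0 < s * (x 0 - p 0) + t * (x 1 - p 1) := by
  obtain ⟨f, c, hfp, hfx⟩ := geometric_hahn_banach_point_closed (convex_convexHull ℝ A)
    (hA.isClosed_convexHull ℝ) hp
  refine ⟨f (EuclideanSpace.single 0 1), f (EuclideanSpace.single 1 1), fun x hx => ?_⟩
  have hlin : ∀ y : EuclideanSpace ℝ (Fin 2),
      f y = y 0 * f (EuclideanSpace.single 0 1) + y 1 * f (EuclideanSpace.single 1 1) := by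
    intro y
    have hy : y = y 0 • EuclideanSpace.single (0 : Fin 2) (1 : ℝ) +
        y 1 • EuclideanSpace.single (1 : Fin 2) (1 : ℝ) := by
      ext i
      fin_cases i <;> simp
    conv_lhs => rw [hy]
    simp
  have := hfp.trans (hfx x (subset_convexHull ℝ A hx))
  rw [hlin p, hlin x] at this
  linarith

/-- Lemma 5.2: in an optimal `k`-point spanning tree of a finite point set in convex
position, every vertex has degree at most 4. -/
theorem optimal_kMST_degree_le_four (P : Finset (EuclideanSpace ℝ (Fin 2)))
    (hP : ∀ p ∈ P, p ∉ convexHull ℝ ((P : Set (EuclideanSpace ℝ (Fin 2))) \ {p}))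
    (k : ℕ) (hk : k ≤ P.card)
    (S : Finset (EuclideanSpace ℝ (Fin 2))) (hSP : S ⊆ P) (hScard : S.card = k)
    (T : SimpleGraph S) (hT : T.IsTree)
    (hopt : ∀ S' : Finset (EuclideanSpace ℝ (Fin 2)), S' ⊆ P → S'.card = k →
      ∀ T' : SimpleGraph S', T'.IsTree → treeLength T ≤ treeLength T') :
    ∀ v : S, T.degree v ≤ 4 := by
  intro v
  by_contra! hdeg
  obtain ⟨s, t, hst⟩ := exists_separating_coordinates (P.finite_toSet.subset Set.sdiff_subset)
    (hP v (hSP v.2))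
  let a : S → ℝ := fun x => s * (x.1 0 - v.1 0) + t * (x.1 1 - v.1 1)
  let b : S → ℝ := fun x => s * (x.1 1 - v.1 1) - t * (x.1 0 - v.1 0)
  have hpos : ∀ x, T.Adj v x → 0 < a x := fun x hx =>
    hst x ⟨hSP x.2, fun h => hx.ne (Subtype.ext h).symm⟩
  have hcard : (Finset.univ : Finset (Prop × Prop)).card < (T.neighborFinset v).card := by
    rw [T.card_neighborFinset_eq_degree]
    simpa using hdeg
  obtain ⟨u, hu, w, hw, huw, heq⟩ := Finset.exists_ne_map_eq_of_card_lt_of_maps_to hcard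
    (f := fun x => (0 ≤ b x, |b x| ≤ a x)) (fun _ _ => Finset.mem_univ _)
  rw [SimpleGraph.mem_neighborFinset] at hu hw
  have hmin : ∀ T' : SimpleGraph S, T'.IsTree → treeLength T ≤ treeLength T' :=
    hopt S hSP hScard
  have key : ∀ x y : S, T.Adj v x → T.Adj v y → x ≠ y →
      2 * (a x * a y + b x * b y) ≤ a y ^ 2 + b y ^ 2 := by
    intro x y hx hy hxy
    have h := dist_le_dist_of_minimal_tree hT hmin hx hy hxy
    rw [EuclideanSpace.dist_eq, EuclideanSpace.dist_eq] at h
    have h := (Real.sqrt_le_sqrt_iff (by positivity)).1 h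
    simp only [Fin.sum_univ_two, Real.dist_eq, sq_abs] at h
    have := mul_le_mul_of_nonneg_left h (add_nonneg (sq_nonneg s) (sq_nonneg t))
    simp only [a, b]
    linarith
  refine false_of_same_octant (hpos u hu) (hpos w hw) (Prod.mk.inj heq).1.to_iff
    (Prod.mk.inj heq).2.to_iff ?_ (key u w hu hw huw)
  linarith [key w u hw hu huw.symm]
end

section
/- Let P be a finite set of points in the Euclidean plane all lying on a circle of radius R > 0 centered at a point o (dist(o,p) = R for every p ∈ P), and assume no two points of P are diametrically opposite (for distinct p, q ∈ P, the midpoint of p and q is not o). Let k ≤ |P|, let S be a k-element subset of P, and let T be a tree on S whose length is at most the length of every tree on every k-element subset of P (i.e., T is an optimal k-point spanning tree of P). Then every vertex of T has degree at most 2 in T. -/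
open scoped Classical

/-- Two points `a`, `b` of a circle centered at the origin which lie strictly on the same side of
the line through the origin and a third point `v` of the circle: if `a` is at least as far from `v`
as `b` is, then `a` is strictly closer to `b` than to `v`. Distances are compared through inner
products. -/
lemma inner_lt_inner_of_same_side {r v₀ v₁ a₀ a₁ b₀ b₁ : ℝ} (hr : 0 < r)
    (hv : v₀ ^ 2 + v₁ ^ 2 = r) (ha : a₀ ^ 2 + a₁ ^ 2 = r) (hb : b₀ ^ 2 + b₁ ^ 2 = r)
    (hside : 0 < (v₀ * a₁ - v₁ * a₀) * (v₀ * b₁ - v₁ * b₀))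
    (hle : v₀ * a₀ + v₁ * a₁ ≤ v₀ * b₀ + v₁ * b₁) :
    v₀ * a₀ + v₁ * a₁ < a₀ * b₀ + a₁ * b₁ := by
  have hc : (v₀ * a₁ - v₁ * a₀) ^ 2 = r ^ 2 - (v₀ * a₀ + v₁ * a₁) ^ 2 := by
    linear_combination (a₀ ^ 2 + a₁ ^ 2) * hv + r * ha
  have hd : (v₀ * b₁ - v₁ * b₀) ^ 2 = r ^ 2 - (v₀ * b₀ + v₁ * b₁) ^ 2 := by
    linear_combination (b₀ ^ 2 + b₁ ^ 2) * hv + r * hb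
  have hab : r * (a₀ * b₀ + a₁ * b₁) = (v₀ * a₀ + v₁ * a₁) * (v₀ * b₀ + v₁ * b₁)
      + (v₀ * a₁ - v₁ * a₀) * (v₀ * b₁ - v₁ * b₀) := by
    linear_combination -(a₀ * b₀ + a₁ * b₁) * hv
  generalize v₀ * a₁ - v₁ * a₀ = c at *
  generalize v₀ * b₁ - v₁ * b₀ = d at *
  generalize v₀ * a₀ + v₁ * a₁ = x at *
  generalize v₀ * b₀ + v₁ * b₁ = y at *
  generalize a₀ * b₀ + a₁ * b₁ = z at *
  have hd0 : 0 < d ^ 2 := by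
    have : d ≠ 0 := right_ne_zero_of_mul hside.ne'
    positivity
  have hy : y < r := lt_of_pow_lt_pow_left₀ 2 hr.le (by linarith)
  have key : x * (r - y) < c * d := by
    rcases le_or_gt x 0 with hx | hx
    · exact (mul_nonpos_of_nonpos_of_nonneg hx (by linarith)).trans_lt hside
    · refine lt_of_pow_lt_pow_left₀ 2 hside.le ?_
      have hdc : d ^ 2 ≤ c ^ 2 := by nlinarith
      calc (x * (r - y)) ^ 2 < ((r + y) * (r - y)) ^ 2 := by
            have : 0 < r - y := by linarith
            gcongr
            linarith
        _ = d ^ 2 * d ^ 2 := by rw [hd]; ring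
        _ ≤ c ^ 2 * d ^ 2 := by gcongr
        _ = (c * d) ^ 2 := by ring
  nlinarith

/-- A point of a circle centered at the origin lies on the line through the origin and a point `v`
of the circle only if it is `v` or its antipode. -/
lemma cross_ne_zero_of_ne_of_ne_neg {r v₀ v₁ a₀ a₁ : ℝ}
    (hv : v₀ ^ 2 + v₁ ^ 2 = r) (ha : a₀ ^ 2 + a₁ ^ 2 = r)
    (hne : ¬(v₀ = a₀ ∧ v₁ = a₁)) (hneg : ¬(v₀ + a₀ = 0 ∧ v₁ + a₁ = 0)) :
    v₀ * a₁ - v₁ * a₀ ≠ 0 := by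
  intro h
  have hx : (r - (v₀ * a₀ + v₁ * a₁)) * (r + (v₀ * a₀ + v₁ * a₁)) = 0 := by
    linear_combination -(a₀ ^ 2 + a₁ ^ 2) * hv - r * ha + (v₀ * a₁ - v₁ * a₀) * h
  rcases mul_eq_zero.mp hx with hx | hx
  · refine hne ⟨?_, ?_⟩ <;> nlinarith [sq_nonneg (v₀ - a₀), sq_nonneg (v₁ - a₁)]
  · refine hneg ⟨?_, ?_⟩ <;> nlinarith [sq_nonneg (v₀ + a₀), sq_nonneg (v₁ + a₁)]

lemma sq_add_sq_eq_of_dist_eq {o p : EuclideanSpace ℝ (Fin 2)} {R : ℝ} (h : dist o p = R) :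
    (p 0 - o 0) ^ 2 + (p 1 - o 1) ^ 2 = R ^ 2 := by
  rw [← h, EuclideanSpace.dist_eq, Real.sq_sqrt (by positivity), Fin.sum_univ_two,
    Real.dist_eq, Real.dist_eq, sq_abs, sq_abs]
  ring

lemma cross_ne_zero_of_midpoint_ne {o v a : EuclideanSpace ℝ (Fin 2)} {R : ℝ}
    (hv : dist o v = R) (ha : dist o a = R) (hne : v ≠ a) (hmid : midpoint ℝ v a ≠ o) :
    (v 0 - o 0) * (a 1 - o 1) - (v 1 - o 1) * (a 0 - o 0) ≠ 0 := by
  refine cross_ne_zero_of_ne_of_ne_neg (sq_add_sq_eq_of_dist_eq hv) (sq_add_sq_eq_of_dist_eq ha)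
    (fun h => hne ?_) (fun h => hmid ?_)
  · ext i
    fin_cases i
    · simpa using h.1
    · simpa using h.2
  · ext i
    fin_cases i
    · simp [midpoint_eq_smul_add]
      linarith [h.1]
    · simp [midpoint_eq_smul_add]
      linarith [h.2]

/-- Of two points of a circle lying strictly on the same side of the diameter through `v`, the one
farther from `v` is strictly closer to the other one than to `v`. -/
lemma dist_lt_dist_of_same_side {o v a b : EuclideanSpace ℝ (Fin 2)} {R : ℝ} (hR : 0 < R)
    (hv : dist o v = R) (ha : dist o a = R) (hb : dist o b = R)
    (hside : 0 < ((v 0 - o 0) * (a 1 - o 1) - (v 1 - o 1) * (a 0 - o 0)) *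
      ((v 0 - o 0) * (b 1 - o 1) - (v 1 - o 1) * (b 0 - o 0)))
    (hle : dist v b ≤ dist v a) : dist a b < dist v a := by
  have hv' := sq_add_sq_eq_of_dist_eq hv
  have ha' := sq_add_sq_eq_of_dist_eq ha
  have hb' := sq_add_sq_eq_of_dist_eq hb
  simp only [EuclideanSpace.dist_eq, Fin.sum_univ_two, Real.dist_eq, sq_abs] at hle ⊢
  rw [Real.sqrt_le_sqrt_iff (by positivity)] at hle
  apply Real.sqrt_lt_sqrt (by positivity)
  have := inner_lt_inner_of_same_side (by positivity) hv' ha' hb' hside (by nlinarith)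
  nlinarith

namespace SimpleGraph

variable {V : Type*}

/-- Exchanging an edge `va` of a tree for the edge `ab`, where `b` is another neighbor of `v`,
gives a tree. -/
lemma IsTree.exchange_edge [Finite V] {T : SimpleGraph V} (hT : T.IsTree) {v a b : V}
    (hva : T.Adj v a) (hvb : T.Adj v b) (hab : a ≠ b) :
    (fromEdgeSet (insert s(a, b) (T.edgeSet \ {s(v, a)}))).IsTree := by
  set T' := fromEdgeSet (insert s(a, b) (T.edgeSet \ {s(v, a)})) with hT'
  have hedges : T'.edgeSet ⊆ insert s(a, b) (T.edgeSet \ {s(v, a)}) := by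
    rw [hT', edgeSet_fromEdgeSet]
    exact Set.sdiff_subset
  have hab' : T'.Adj a b := by simp [hT', hab]
  have hvb' : T'.Adj v b := by
    simp [hT', hvb, hvb.ne, hab.symm, hva.ne]
  have hreach : ∀ x y, T.Adj x y → T'.Reachable x y := by
    intro x y hxy
    by_cases he : s(x, y) = s(v, a)
    · have hva' : T'.Reachable v a := hvb'.reachable.trans hab'.symm.reachable
      rcases Sym2.eq_iff.mp he with ⟨rfl, rfl⟩ | ⟨rfl, rfl⟩
      · exact hva'
      · exact hva'.symm
    · refine Adj.reachable ?_
      rw [hT', fromEdgeSet_adj]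
      exact ⟨Or.inr ⟨hxy, he⟩, hxy.ne⟩
  have hconn : T'.Connected := by
    have := hT.connected.nonempty
    refine ⟨fun x y => ?_⟩
    obtain ⟨w⟩ := hT.connected x y
    induction w with
    | nil => rfl
    | cons h _ ih => exact (hreach _ _ h).trans ih
  refine isTree_iff_connected_and_card.mpr ⟨hconn, le_antisymm ?_ ?_⟩
  · rw [← (isTree_iff_connected_and_card.mp hT).2, Nat.card_coe_set_eq, Nat.card_coe_set_eq]
    refine Nat.add_le_add_right ?_ 1
    calc T'.edgeSet.ncard ≤ (insert s(a, b) (T.edgeSet \ {s(v, a)})).ncard :=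
          Set.ncard_le_ncard hedges (Set.toFinite _)
      _ ≤ (T.edgeSet \ {s(v, a)}).ncard + 1 := Set.ncard_insert_le _ _
      _ = T.edgeSet.ncard := Set.ncard_sdiff_singleton_add_one hva (Set.toFinite _)
  · exact hconn.card_vert_le_card_edgeSet_add_one

end SimpleGraph

/-- Exchanging an edge for a strictly shorter one makes a graph strictly shorter. -/
lemma treeLength_exchange_edge_lt {S : Finset (EuclideanSpace ℝ (Fin 2))} {T : SimpleGraph S}
    {v a b : S} (hva : T.Adj v a) (hlt : dist (a : EuclideanSpace ℝ (Fin 2)) b <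
      dist (v : EuclideanSpace ℝ (Fin 2)) a) :
    treeLength (SimpleGraph.fromEdgeSet (insert s(a, b) (T.edgeSet \ {s(v, a)}))) <
      treeLength T := by
  unfold treeLength
  set f : Sym2 S → ℝ := Sym2.lift
    ⟨fun (a b : S) => dist (a : EuclideanSpace ℝ (Fin 2)) (b : EuclideanSpace ℝ (Fin 2)),
      fun _ _ => dist_comm _ _⟩
  have hnonneg : ∀ e, 0 ≤ f e := fun e => by
    induction e with
    | _ x y => exact dist_nonneg (x := (x : EuclideanSpace ℝ (Fin 2)))
  have hsub : (SimpleGraph.fromEdgeSet (insert s(a, b) (T.edgeSet \ {s(v, a)}))).edgeFinset ⊆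
      insert s(a, b) (T.edgeFinset.erase s(v, a)) := by
    intro e he
    simp only [SimpleGraph.mem_edgeFinset, SimpleGraph.edgeSet_fromEdgeSet, Set.mem_sdiff,
      Set.mem_insert_iff, Set.mem_singleton_iff, Finset.mem_insert, Finset.mem_erase] at he ⊢
    tauto
  refine lt_of_le_of_lt (b := ∑ e ∈ insert s(a, b) (T.edgeFinset.erase s(v, a)), f e) ?_ ?_
  · convert Finset.sum_le_sum_of_subset_of_nonneg hsub fun e _ _ => hnonneg e
  calc ∑ e ∈ insert s(a, b) (T.edgeFinset.erase s(v, a)), f e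
      ≤ f s(a, b) + ∑ e ∈ T.edgeFinset.erase s(v, a), f e := by
        by_cases h : s(a, b) ∈ T.edgeFinset.erase s(v, a)
        · rw [Finset.insert_eq_of_mem h]
          exact le_add_of_nonneg_left (hnonneg _)
        · rw [Finset.sum_insert h]
    _ < f s(v, a) + ∑ e ∈ T.edgeFinset.erase s(v, a), f e := by
        gcongr
        exact hlt
    _ = ∑ e ∈ T.edgeFinset, f e :=
        Finset.add_sum_erase _ _ (SimpleGraph.mem_edgeFinset.mpr hva)

/-- Lemma 5.4: in an optimal `k`-point spanning tree of a finite point set on a circle,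
no two points diametrically opposite, every vertex has degree at most 2. -/
theorem optimal_kMST_on_circle_degree_le_two (P : Finset (EuclideanSpace ℝ (Fin 2)))
    (o : EuclideanSpace ℝ (Fin 2)) (R : ℝ) (hR : 0 < R)
    (hcirc : ∀ p ∈ P, dist o p = R)
    (hdiam : ∀ p ∈ P, ∀ q ∈ P, p ≠ q → midpoint ℝ p q ≠ o)
    (k : ℕ) (hk : k ≤ P.card)
    (S : Finset (EuclideanSpace ℝ (Fin 2))) (hSP : S ⊆ P) (hScard : S.card = k)
    (T : SimpleGraph S) (hT : T.IsTree)
    (hopt : ∀ S' : Finset (EuclideanSpace ℝ (Fin 2)), S' ⊆ P → S'.card = k →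
      ∀ T' : SimpleGraph S', T'.IsTree → treeLength T ≤ treeLength T') :
    ∀ v : S, T.degree v ≤ 2 := by
  intro v
  by_contra! hdeg
  have hon : ∀ p : S, dist o (p : EuclideanSpace ℝ (Fin 2)) = R := fun p => hcirc p (hSP p.2)
  let cross : S → ℝ := fun p =>
    (v.1 0 - o 0) * (p.1 1 - o 1) - (v.1 1 - o 1) * (p.1 0 - o 0)
  have hcross : ∀ p, T.Adj v p → cross p ≠ 0 := fun p hp => by
    have hne : (v : EuclideanSpace ℝ (Fin 2)) ≠ p := Subtype.coe_ne_coe.mpr hp.ne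
    exact cross_ne_zero_of_midpoint_ne (hon v) (hon p) hne
      (hdiam v (hSP v.2) p (hSP p.2) hne)
  have hexchange : ∀ a b, T.Adj v a → T.Adj v b → a ≠ b → 0 < cross a * cross b →
      ¬ dist (v : EuclideanSpace ℝ (Fin 2)) b ≤ dist (v : EuclideanSpace ℝ (Fin 2)) a :=
    fun a b ha hb hab hside hle =>
      (treeLength_exchange_edge_lt ha
        (dist_lt_dist_of_same_side hR (hon v) (hon a) (hon b) hside hle)).not_ge
        (hopt S hSP hScard _ (hT.exchange_edge ha hb hab))
  have hopposite : ∀ a b, T.Adj v a → T.Adj v b → a ≠ b → cross a * cross b < 0 := by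
    intro a b ha hb hab
    refine lt_of_le_of_ne (le_of_not_gt fun hside => ?_) (mul_ne_zero (hcross a ha) (hcross b hb))
    rcases le_total (dist (v : EuclideanSpace ℝ (Fin 2)) b) (dist (v : EuclideanSpace ℝ (Fin 2)) a)
      with h | h
    · exact hexchange a b ha hb hab hside h
    · exact hexchange b a hb ha hab.symm (by rwa [mul_comm]) h
  clear_value cross
  rw [← SimpleGraph.card_neighborFinset_eq_degree, Finset.two_lt_card] at hdeg
  obtain ⟨a, ha, b, hb, c, hc, hab, hac, hbc⟩ := hdeg
  rw [SimpleGraph.mem_neighborFinset] at ha hb hc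
  have h := mul_pos_of_neg_of_neg (hopposite a b ha hb hab) (hopposite a c ha hc hac)
  nlinarith [mul_nonpos_of_nonneg_of_nonpos (sq_nonneg (cross a)) (hopposite b c hb hc hbc).le]
end
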